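/- Let ℓ ≥ 3 and κ ≥ 1 be integers, and let G be a graph with no induced cycle of length more than ℓ, such that for every vertex v, both the neighbourhood N(v) and the second neighbourhood N^2(v) (vertices at distance exactly 2 from v) induce subgraphs with chromatic number at most κ. Then χ(G) ≤ (2ℓ−2)κ. -/

import Mathlib

/-- `G` has an induced cycle (hole) of length `n`. -/
def HasInducedCycle {V : Type*} (G : SimpleGraph V) (n : ℕ) : Prop :=
  ∃ f : ZMod n → V, Function.Injective f ∧
    ∀ i j : ZMod n, G.Adj (f i) (f j) ↔ (j = i + 1 ∨ i = j + 1)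

/-- `S` can be properly coloured with `n` colours. -/
def Col {V : Type*} (G : SimpleGraph V) (S : Set V) (n : ℕ) : Prop :=
  ∃ c : V → ℕ, ∀ v ∈ S, c v < n ∧ ∀ u ∈ S, G.Adj v u → c v ≠ c u

/-- `S` is (pre)connected. -/
def Conn {V : Type*} (G : SimpleGraph V) (S : Set V) : Prop :=
  ∀ A : Set V, (∃ a ∈ S, a ∈ A) → (∀ a ∈ A, a ∈ S → ∀ b ∈ S, G.Adj a b → b ∈ A) → S ⊆ A

/-- `p 0, ..., p m` is an induced path. -/
def IndPath {V : Type*} (G : SimpleGraph V) (p : ℕ → V) (m : ℕ) : Prop :=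
  ∀ i j, i < j → j ≤ m → p i ≠ p j ∧ (G.Adj (p i) (p j) ↔ j = i + 1)

/-- `v` has distance at least three from `D`, up to membership. -/
def Far {V : Type*} (G : SimpleGraph V) (v : V) (D : Set V) : Prop :=
  ∀ u ∈ D, ¬ G.Adj v u ∧ ∀ x, G.Adj x u → ¬ G.Adj v x

theorem Col.mono {V : Type*} {G : SimpleGraph V} {S T : Set V} {n m : ℕ}
    (h : Col G S n) (hT : T ⊆ S) (hn : n ≤ m) : Col G T m := by
  obtain ⟨c, hc⟩ := h
  exact ⟨c, fun v hv => ⟨lt_of_lt_of_le (hc v (hT hv)).1 hn,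
    fun u hu => (hc v (hT hv)).2 u (hT hu)⟩⟩

theorem Col.of_chrom {V : Type*} {G : SimpleGraph V} {S : Set V} {n : ℕ}
    (h : (G.induce S).chromaticNumber ≤ (n : ℕ∞)) : Col G S n := by
  classical
  rw [SimpleGraph.chromaticNumber_le_iff_colorable] at h
  obtain ⟨c⟩ := h
  refine ⟨fun v => if hv : v ∈ S then (c ⟨v, hv⟩ : ℕ) else 0, fun v hv => ?_⟩
  refine ⟨by simp [hv], fun u hu huv => ?_⟩
  simp only [hv, hu, dif_pos]
  intro he
  exact c.valid (v := ⟨v, hv⟩) (w := ⟨u, hu⟩) (by simpa using huv) (Fin.ext he)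

theorem Col.union {V : Type*} {G : SimpleGraph V} {S T : Set V} {n m : ℕ}
    (h : Col G S n) (h' : Col G T m) : Col G (S ∪ T) (n + m) := by
  classical
  obtain ⟨c, hc⟩ := h
  obtain ⟨d, hd⟩ := h'
  refine ⟨fun v => if v ∈ S then c v else n + d v, fun v hv => ?_⟩
  have hv' : v ∉ S → v ∈ T := fun h => hv.resolve_left h
  constructor
  · by_cases h : v ∈ S
    · simp only [h, if_true]; have := (hc v h).1; omega
    · simp only [h, if_false]; have := (hd v (hv' h)).1; omega
  · intro u hu huv
    have hu' : u ∉ S → u ∈ T := fun h => hu.resolve_left h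
    by_cases h : v ∈ S <;> by_cases h2 : u ∈ S <;> simp only [h, h2, if_true, if_false]
    · exact (hc v h).2 u h2 huv
    · have := (hc v h).1; omega
    · have := (hc u h2).1; omega
    · have := (hd v (hv' h)).2 u (hu' h2) huv; omega

theorem exists_conn {V : Type*} [Finite V] {G : SimpleGraph V} {S : Set V} {n : ℕ}
    (h : ¬ Col G S n) : ∃ T ⊆ S, ¬ Col G T n ∧ Conn G T := by
  classical
  obtain ⟨T, hTS, hT⟩ := exists_minimal_le_of_wellFoundedLT (fun T : Set V => ¬ Col G T n) S h
  refine ⟨T, hTS, hT.prop, ?_⟩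
  intro A hA hcl
  by_contra hn
  apply hT.prop
  have key : ∀ B : Set V, ¬ T ⊆ B → Col G (T ∩ B) n := by
    intro B hB
    by_contra hc
    exact hB (fun x hx => (hT.le_of_le hc Set.inter_subset_left hx).2)
  obtain ⟨c, hc⟩ := key A hn
  obtain ⟨d, hd⟩ := key Aᶜ (by
    obtain ⟨a, ha, haA⟩ := hA
    intro h; exact h ha haA)
  refine ⟨fun v => if v ∈ A then c v else d v, fun v hv => ?_⟩
  constructor
  · by_cases h : v ∈ A
    · simp only [h, if_true]; exact (hc v ⟨hv, h⟩).1
    · simp only [h, if_false]; exact (hd v ⟨hv, h⟩).1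
  · intro u hu huv
    by_cases h : v ∈ A <;> by_cases h2 : u ∈ A <;> simp only [h, h2, if_true, if_false]
    · exact (hc v ⟨hv, h⟩).2 u ⟨hu, h2⟩ huv
    · exact absurd (hcl v h hv u hu huv) h2
    · exact absurd (hcl u h2 hu v hv huv.symm) h
    · exact (hd v ⟨hv, h⟩).2 u ⟨hu, h2⟩ huv

theorem exists_path {V : Type*} {G : SimpleGraph V} {S : Set V} {x : V} (hx : x ∈ S)
    (R : V → Prop)
    (h : ∀ A : Set V, x ∈ A → (∀ a ∈ A, a ∈ S → ∀ b ∈ S, G.Adj a b → b ∈ A) →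
      ∃ a ∈ A, a ∈ S ∧ R a) :
    ∃ (q : ℕ → V) (r : ℕ), q 0 = x ∧ (∀ i ≤ r, q i ∈ S) ∧ IndPath G q r ∧ R (q r) ∧
      (∀ i < r, ¬ R (q i)) ∧ (∀ i < r, G.Adj (q i) (q (i+1))) := by
  classical
  have hex : ∃ r, ∃ q : ℕ → V, q 0 = x ∧ (∀ i ≤ r, q i ∈ S) ∧
      (∀ i < r, G.Adj (q i) (q (i+1))) ∧ R (q r) := by
    obtain ⟨a, ⟨r, q, h0, hS, hadj, hr⟩, -, hR⟩ := h {v | ∃ r, ∃ q : ℕ → V, q 0 = x ∧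
      (∀ i ≤ r, q i ∈ S) ∧ (∀ i < r, G.Adj (q i) (q (i+1))) ∧ q r = v}
      ⟨0, fun _ => x, rfl, fun _ _ => hx, fun _ h => by omega, rfl⟩ (by
        rintro a ⟨r, q, h0, hS, hadj, hr⟩ haS b hb hab
        refine ⟨r+1, fun i => if i ≤ r then q i else b, by simp [h0], ?_, ?_, by simp⟩
        · intro i hi
          by_cases h : i ≤ r
          · simp only [h, if_true]; exact hS i h
          · simp only [h, if_false]; exact hb
        · intro i hi
          by_cases h : i < r
          · have h1 : i ≤ r := by omega
            have h2 : i + 1 ≤ r := by omega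
            simp only [h1, h2, if_true]; exact hadj i h
          · have h1 : i = r := by omega
            subst h1
            simp [hr, hab])
    exact ⟨r, q, h0, hS, hadj, hr ▸ hR⟩
  obtain ⟨q, h0, hS, hadj, hR⟩ := Nat.find_spec hex
  have hmin := fun m => Nat.find_min (H := hex) (m := m)
  generalize Nat.find hex = r at *
  -- shortcut lemma
  have short : ∀ i e, 0 < e → i + 1 + e ≤ r → ¬ G.Adj (q i) (q (i + 1 + e)) := by
    intro i e he hie hA
    refine hmin (r - e) (by omega) ⟨fun t => if t ≤ i then q t else q (t + e), by simp [h0],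
      ?_, ?_, ?_⟩
    · intro t ht
      by_cases h : t ≤ i
      · simp only [h, if_true]; exact hS t (by omega)
      · simp only [h, if_false]; exact hS _ (by omega)
    · intro t ht
      rcases lt_trichotomy t i with h | h | h
      · have h1 : t ≤ i := by omega
        have h2 : t + 1 ≤ i := by omega
        simp only [h1, h2, if_true]; exact hadj t (by omega)
      · subst h
        simpa using hA
      · have h1 : ¬ t ≤ i := by omega
        have h2 : ¬ t + 1 ≤ i := by omega
        simp only [h1, h2, if_false]
        have := hadj (t + e) (by omega)
        rwa [show t + e + 1 = t + 1 + e by omega] at this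
    · have h1 : ¬ r - e ≤ i := by omega
      simp only [h1, if_false]
      rwa [show r - e + e = r by omega]
  have hnR : ∀ i < r, ¬ R (q i) := fun i hi hRi =>
    hmin i hi ⟨q, h0, fun t ht => hS t (by omega), fun t ht => hadj t (by omega), hRi⟩
  refine ⟨q, r, h0, hS, ?_, hR, hnR, hadj⟩
  intro i j hij hj
  constructor
  · intro he
    by_cases hjr : j = r
    · subst hjr
      exact hnR i hij (he ▸ hR)
    · have h1 := hadj j (by omega)
      rw [← he] at h1
      refine short i (j - i) (by omega) (by omega) ?_
      rwa [show i + 1 + (j - i) = j + 1 by omega]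
  · constructor
    · intro hA
      by_contra hne
      refine short i (j - i - 1) (by omega) (by omega) ?_
      rwa [show i + 1 + (j - i - 1) = j by omega]
    · rintro rfl
      exact hadj i (by omega)

theorem cycle_of_nat {V : Type*} {G : SimpleGraph V} {n : ℕ} (hn : 3 ≤ n) (g : ℕ → V)
    (hg : ∀ a b, a < b → b < n → g a ≠ g b ∧
      (G.Adj (g a) (g b) ↔ (b = a + 1 ∨ (a = 0 ∧ b + 1 = n)))) : HasInducedCycle G n := by
  haveI : NeZero n := ⟨by omega⟩
  haveI : Fact (1 < n) := ⟨by omega⟩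
  have hs : ∀ i j : ZMod n, j = i + 1 ↔
      (j.val = i.val + 1 ∨ (j.val = 0 ∧ i.val + 1 = n)) := by
    intro i j
    have hi := ZMod.val_lt i
    have hj := ZMod.val_lt j
    rw [← (ZMod.val_injective n).eq_iff, ZMod.val_add, ZMod.val_one]
    by_cases h : i.val + 1 = n
    · rw [h, Nat.mod_self]; omega
    · rw [Nat.mod_eq_of_lt (by omega)]; omega
  refine ⟨fun i => g i.val, ?_, ?_⟩
  · intro i j hij
    simp only at hij
    rcases lt_trichotomy i.val j.val with h | h | h
    · exact absurd hij (hg _ _ h (ZMod.val_lt j)).1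
    · exact ZMod.val_injective n h
    · exact absurd hij.symm (hg _ _ h (ZMod.val_lt i)).1
  · intro i j
    rw [hs i j, hs j i]
    have hi := ZMod.val_lt i
    have hj := ZMod.val_lt j
    rcases lt_trichotomy i.val j.val with h | h | h
    · rw [(hg _ _ h (ZMod.val_lt j)).2]; omega
    · beta_reduce
      rw [h]
      have hirr : ¬ G.Adj (g j.val) (g j.val) := fun h => h.ne rfl
      simp only [hirr, false_iff]; omega
    · rw [G.adj_comm, (hg _ _ h (ZMod.val_lt i)).2]; omega

theorem exists_parent {V : Type*} {G : SimpleGraph V} {z u : V} {d : ℕ}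
    (hr : G.Reachable z u) (hd : G.dist z u = d + 1) :
    ∃ x, G.Adj x u ∧ G.Reachable z x ∧ G.dist z x = d := by
  obtain ⟨p, hp⟩ := hr.symm.exists_walk_length_eq_dist
  rw [G.dist_comm, hd] at hp
  cases p with
  | nil => simp at hp
  | cons h p' =>
    rename_i x
    have hl : p'.length = d := by simpa using hp
    have h1 : G.dist z x ≤ d := by
      rw [G.dist_comm, ← hl]; exact SimpleGraph.dist_le p'
    have hr' : G.Reachable z x := p'.reachable.symm
    refine ⟨x, h.symm, hr', ?_⟩
    obtain ⟨w, hw⟩ := hr'.exists_walk_length_eq_dist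
    have := SimpleGraph.dist_le (w.concat h.symm)
    rw [SimpleGraph.Walk.length_concat] at this
    omega

theorem dist_step {V : Type*} {G : SimpleGraph V} {z x u : V}
    (hr : G.Reachable z x) (h : G.Adj x u) : G.dist z u ≤ G.dist z x + 1 := by
  obtain ⟨w, hw⟩ := hr.exists_walk_length_eq_dist
  have := SimpleGraph.dist_le (w.concat h)
  rw [SimpleGraph.Walk.length_concat] at this
  omega

theorem dist_two {V : Type*} {G : SimpleGraph V} {v x u : V}
    (h1 : G.Adj v x) (h2 : G.Adj x u) (hne : v ≠ u) (hna : ¬ G.Adj v u) : G.dist v u = 2 := by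
  have hle := dist_step h1.reachable h2
  have h1' : G.dist v x = 1 := SimpleGraph.dist_eq_one_iff_adj.2 h1
  have hr : G.Reachable v u := h1.reachable.trans h2.reachable
  have h0 : G.dist v u ≠ 0 := fun h => hne (hr.dist_eq_zero_iff.1 h)
  have h3 : G.dist v u ≠ 1 := fun h => hna (SimpleGraph.dist_eq_one_iff_adj.1 h)
  omega

/-- The Gyárfás-type path. -/
theorem path_step {V : Type*} [Finite V] {G : SimpleGraph V} {κ : ℕ}
    (h1 : ∀ v, Col G (G.neighborSet v) κ) (h2 : ∀ v, Col G {u | G.dist v u = 2} κ)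
    {D0 : Set V} (hD0 : Conn G D0) {v0 : V} (hv0 : v0 ∉ D0) (hadj : ∃ u ∈ D0, G.Adj v0 u)
    {N : ℕ} (hcol : ¬ Col G D0 ((N + 1) * κ)) :
    ∀ i ≤ N, ∃ (D : Set V) (p : ℕ → V) (m : ℕ), D ⊆ D0 ∧ Conn G D ∧
      ¬ Col G D ((N - i + 1) * κ) ∧ i ≤ m ∧ p 0 = v0 ∧ (∀ a, 1 ≤ a → a ≤ m → p a ∈ D0) ∧
      IndPath G p m ∧ (∀ a ≤ m, p a ∉ D) ∧ (∀ a < m, ∀ u ∈ D, ¬ G.Adj (p a) u) ∧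
      (∃ u ∈ D, G.Adj (p m) u) ∧ (∀ a < i, Far G (p a) D) := by
  intro i
  induction i with
  | zero =>
    intro _
    exact ⟨D0, fun _ => v0, 0, subset_rfl, hD0, hcol, le_rfl, rfl, fun a _ _ => by omega,
      fun i j _ _ => by omega, fun _ _ => hv0, fun a h => by omega, hadj, fun a h => by omega⟩
  | succ i ih =>
    intro hi
    obtain ⟨D, p, m, hDD, hconn, hc, him, hp0, hpD, hind, hpn, hna, hlast, hfar⟩ :=
      ih (by omega)
    have hc' : ¬ Col G (D \ {u | G.dist (p i) u = 2}) ((N - (i+1) + 1) * κ) := by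
      intro h
      apply hc
      refine (h.union (h2 (p i))).mono ?_ ?_
      · intro x hx
        by_cases hx2 : G.dist (p i) x = 2
        · exact Or.inr hx2
        · exact Or.inl ⟨hx, hx2⟩
      · rw [show N - i + 1 = (N - (i+1) + 1) + 1 by omega, Nat.add_mul (N - (i+1) + 1) 1, one_mul]
    obtain ⟨T, hTS, hTc, hTconn⟩ := exists_conn hc'
    have hTD : T ⊆ D := fun x hx => (hTS hx).1
    have hpiD : p i ∉ D := hpn i him
    have hT2 : ∀ x ∈ T, G.dist (p i) x ≠ 2 := fun x hx => (hTS hx).2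
    have hnoadj : ∀ u ∈ T, ¬ G.Adj (p i) u := by
      intro u hu hau
      have : T ⊆ G.neighborSet (p i) := by
        apply hTconn _ ⟨u, hu, hau⟩
        intro a ha haT b hb hab
        by_contra hn
        exact hT2 b hb (dist_two ha hab (fun h => hpiD (h ▸ hTD hb)) hn)
      refine hTc ((h1 (p i)).mono this ?_)
      exact Nat.le_mul_of_pos_left _ (by omega)
    have hfarT : Far G (p i) T := by
      intro u hu
      refine ⟨hnoadj u hu, fun x hx hvx => ?_⟩
      exact hT2 u hu (dist_two hvx hx (fun h => hpiD (h ▸ hTD hu)) (hnoadj u hu))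
    have hTne : ∃ t, t ∈ T := by
      by_contra hn
      push Not at hn
      exact hTc ⟨fun _ => 0, fun v hv => absurd hv (hn v)⟩
    obtain ⟨t, ht⟩ := hTne
    have hpm : p m ∉ D := hpn m le_rfl
    obtain ⟨q, r, hq0, hqS, hqind, hqR, hqn, hqadj⟩ :=
      exists_path (G := G) (S := insert (p m) D) (x := p m) (Set.mem_insert _ _)
        (fun u => ∃ s ∈ T, G.Adj u s) (by
        intro A hxA hcl
        by_contra hn
        push Not at hn
        obtain ⟨u, hu, hmu⟩ := hlast
        have huA := hcl _ hxA (Set.mem_insert _ _) u (Set.mem_insert_of_mem _ hu) hmu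
        have hDA : D ⊆ A := by
          apply hconn A ⟨u, hu, huA⟩
          intro a ha haD b hb hab
          exact hcl a ha (Set.mem_insert_of_mem _ haD) b (Set.mem_insert_of_mem _ hb) hab
        have hsub : D ⊆ Tᶜ := by
          have hn' : ∀ a ∈ D, ∀ s ∈ T, ¬ G.Adj a s := fun a ha =>
            hn a (hDA ha) (Set.mem_insert_of_mem _ ha)
          have huT : u ∉ T := fun h => hn (p m) hxA (Set.mem_insert _ _) u h hmu
          exact hconn _ ⟨u, hu, huT⟩ (fun a ha haD b hb hab hbT => hn' a haD b hbT hab)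
        exact hsub (hTD ht) ht)
    have hqD : ∀ a, 1 ≤ a → a ≤ r → q a ∈ D := by
      intro a ha har
      rcases hqS a har with h | h
      · exact absurd (hq0.trans h.symm) (hqind 0 a (by omega) har).1
      · exact h
    have hqT : ∀ a ≤ r, q a ∉ T := by
      intro a har hT
      rcases Nat.eq_zero_or_pos a with h | h
      · subst h; rw [hq0] at hT; exact hpm (hTD hT)
      · have := hqadj (a - 1) (by omega)
        rw [show a - 1 + 1 = a by omega] at this
        exact hqn (a-1) (by omega) ⟨_, hT, this⟩
    have hr1 : i + 1 ≤ m + r := by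
      by_contra hlt
      have e1 : r = 0 := by omega
      have e2 : m = i := by omega
      subst e1 e2
      obtain ⟨s, hs, hqs⟩ := hqR
      rw [hq0] at hqs
      exact hnoadj s hs hqs
    have hnew : ∀ a, m ≤ a → (if a ≤ m then p a else q (a - m)) = q (a - m) := by
      intro a ha
      by_cases h : a ≤ m
      · have : a = m := by omega
        subst this; simp [hq0]
      · simp [h]
    have hold : ∀ a, a ≤ m → (if a ≤ m then p a else q (a - m)) = p a := by
      intro a ha; simp [ha]
    refine ⟨T, fun a => if a ≤ m then p a else q (a - m), m + r, hTD.trans hDD, hTconn, hTc,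
      hr1, by simp [hp0], ?_, ?_, ?_, ?_, ?_, ?_⟩
    · intro a ha1 ha
      by_cases h : a ≤ m
      · simp only [h, if_true]; exact hpD a ha1 h
      · simp only [h, if_false]; exact hDD (hqD _ (by omega) (by omega))
    · intro a b hab hb
      beta_reduce
      by_cases hbm : b ≤ m
      · rw [hold a (by omega), hold b hbm]; exact hind a b hab hbm
      · rw [hnew b (by omega)]
        by_cases ham : a < m
        · rw [hold a (by omega)]
          have hbD := hqD (b - m) (by omega) (by omega)
          refine ⟨fun h => hpn a (by omega) (h ▸ hbD), ?_⟩
          have := hna a ham _ hbD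
          simp only [this, false_iff]; omega
        · rw [hnew a (by omega)]
          have := hqind (a - m) (b - m) (by omega) (by omega)
          refine ⟨this.1, this.2.trans ?_⟩
          omega
    · intro a ha
      beta_reduce
      by_cases h : a ≤ m
      · rw [hold a h]; exact fun h' => hpn a h (hTD h')
      · rw [hnew a (by omega)]; exact hqT _ (by omega)
    · intro a ha u hu
      beta_reduce
      by_cases h : a < m
      · rw [hold a (by omega)]; exact hna a h u (hTD hu)
      · rw [hnew a (by omega)]
        exact fun h' => hqn (a - m) (by omega) ⟨u, hu, h'⟩
    · beta_reduce
      rw [hnew (m + r) (by omega), Nat.add_sub_cancel_left]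
      exact hqR
    · intro a ha
      beta_reduce
      rw [hold a (by omega)]
      rcases Nat.lt_succ_iff_lt_or_eq.1 ha with h | h
      · exact fun u hu => hfar a h u (hTD hu)
      · rw [h]; exact hfarT

/-- The main argument inside one level. -/
theorem level_hole {V : Type*} [Finite V] {G : SimpleGraph V} {κ : ℕ}
    (h1 : ∀ v, Col G (G.neighborSet v) κ) (h2 : ∀ v, Col G {u | G.dist v u = 2} κ)
    (z : V) (k : ℕ) {D0 : Set V} (hD0 : Conn G D0)
    (hlev : ∀ u ∈ D0, G.Reachable z u ∧ G.dist z u = k + 1)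
    {N : ℕ} (hN : 1 ≤ N) (hcol : ¬ Col G D0 ((N + 1) * κ)) :
    ∃ n, N + 3 ≤ n ∧ HasInducedCycle G n := by
  classical
  have hne : ∃ t, t ∈ D0 := by
    by_contra hn
    push Not at hn
    exact hcol ⟨fun _ => 0, fun v hv => absurd hv (hn v)⟩
  obtain ⟨t, ht⟩ := hne
  obtain ⟨v0, hv0t, hv0r, hv0d⟩ := exists_parent (hlev t ht).1 (hlev t ht).2
  have hv0 : v0 ∉ D0 := fun h => by have := (hlev _ h).2; omega
  obtain ⟨D, p, m, hDD, hconn, hc, him, hp0, hpD, hind, hpn, hna, ⟨w, hwD, hmw⟩, hfar⟩ :=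
    path_step h1 h2 hD0 hv0 ⟨t, ht, hv0t⟩ hcol N le_rfl
  obtain ⟨y, hyw, hyr, hyd⟩ := exists_parent (hlev w (hDD hwD)).1 (hlev w (hDD hwD)).2
  have hv0y : v0 ≠ y := by
    rintro rfl
    have := (hfar 0 (by omega) w hwD).1
    rw [hp0] at this
    exact this hyw
  have hv0ny : ¬ G.Adj v0 y := by
    have := (hfar 0 (by omega) w hwD).2 y hyw
    rwa [hp0] at this
  -- extended path
  obtain ⟨P, hPold, hPw⟩ : ∃ P : ℕ → V, (∀ a ≤ m, P a = p a) ∧ P (m + 1) = w :=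
    ⟨fun a => if a ≤ m then p a else w, fun a ha => by simp [ha], by simp⟩
  have hPind : IndPath G P (m + 1) := by
    intro a b hab hb
    by_cases hbm : b ≤ m
    · rw [hPold a (by omega), hPold b hbm]; exact hind a b hab hbm
    · have : b = m + 1 := by omega
      subst this
      rw [hPw, hPold a (by omega)]
      refine ⟨fun h => hpn a (by omega) (h ▸ hwD), ?_⟩
      by_cases ham : a = m
      · subst ham; simp [hmw]
      · have := hna a (by omega) w hwD
        simp only [this, false_iff]; omega
  have hPD : ∀ a, 1 ≤ a → a ≤ m + 1 → P a ∈ D0 := by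
    intro a ha1 ha
    by_cases h : a ≤ m
    · rw [hPold a h]; exact hpD a ha1 h
    · have : a = m + 1 := by omega
      rw [this, hPw]; exact hDD hwD
  have hP0 : P 0 = v0 := by rw [hPold 0 (by omega), hp0]
  have hex : ∃ j, j ≤ m + 1 ∧ G.Adj (P j) y := ⟨m + 1, le_rfl, by rw [hPw]; exact hyw.symm⟩
  obtain ⟨hjm, hjy⟩ := Nat.find_spec hex
  have hmin := fun a => Nat.find_min (H := hex) (m := a)
  generalize Nat.find hex = j at *
  have hjN : N ≤ j := by
    by_contra hlt
    have := (hfar j (by omega) w hwD).2 y hyw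
    rw [← hPold j (by omega)] at this
    exact this hjy
  -- upper path
  have hup : ∀ (A : Set V), (∀ a ∈ A, a ∈ ({v0, y} ∪ {u | G.Reachable z u ∧ G.dist z u < k} : Set V)
      → ∀ b ∈ ({v0, y} ∪ {u | G.Reachable z u ∧ G.dist z u < k} : Set V), G.Adj a b → b ∈ A) →
      ∀ d u, u ∈ ({v0, y} ∪ {u | G.Reachable z u ∧ G.dist z u < k} : Set V) →
      G.Reachable z u → G.dist z u = d → d ≤ k → (u ∈ A ↔ z ∈ A) := by
    intro A hA d
    induction d with
    | zero =>
      intro u _ hr hd _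
      rw [hr.dist_eq_zero_iff.1 hd]
    | succ d ih =>
      intro u hu hr hd hdk
      obtain ⟨x, hxu, hxr, hxd⟩ := exists_parent hr hd
      have hxS : x ∈ ({v0, y} ∪ {u | G.Reachable z u ∧ G.dist z u < k} : Set V) :=
        Or.inr ⟨hxr, by omega⟩
      rw [← ih x hxS hxr hxd (by omega)]
      exact ⟨fun h => hA u h hu x hxS hxu.symm, fun h => hA x h hxS u hu hxu⟩
  obtain ⟨q, r, hq0, hqS, hqind, hqR, hqn, hqadj⟩ :=
    exists_path (G := G) (S := {v0, y} ∪ {u | G.Reachable z u ∧ G.dist z u < k}) (x := y)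
      (by simp) (fun u => u = v0) (by
        intro A hyA hcl
        refine ⟨v0, ?_, by simp, rfl⟩
        rw [hup A hcl k v0 (by simp) hv0r hv0d le_rfl, ← hup A hcl k y (by simp) hyr hyd le_rfl]
        exact hyA)
  have hr2 : 2 ≤ r := by
    rcases r with _ | _ | r
    · exact absurd (hqR.symm.trans hq0) hv0y
    · have := hqadj 0 (by omega)
      rw [hq0, show 0 + 1 = 1 from rfl, show q 1 = v0 from hqR] at this
      exact absurd this.symm hv0ny
    · omega
  have hqup : ∀ s, 1 ≤ s → s < r → G.Reachable z (q s) ∧ G.dist z (q s) < k := by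
    intro s hs hsr
    rcases hqS s hsr.le with (h | h) | h
    · exact absurd h (hqn s hsr)
    · exact absurd (hq0.trans h.symm) (hqind 0 s (by omega) hsr.le).1
    · exact h
  refine ⟨j + 1 + r, by omega, cycle_of_nat (by omega)
    (fun a => if a ≤ j then P a else q (a - (j + 1))) ?_⟩
  intro a b hab hb
  beta_reduce
  by_cases hbj : b ≤ j
  · rw [if_pos hbj, if_pos (by omega)]
    have := hPind a b hab (by omega)
    refine ⟨this.1, this.2.trans ?_⟩
    omega
  rw [if_neg hbj]
  by_cases haj : a ≤ j
  · rw [if_pos haj]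
    by_cases hs : b = j + 1
    · subst hs
      rw [Nat.sub_self, hq0]
      constructor
      · rcases Nat.eq_zero_or_pos a with h | h
        · rw [h, hP0]; exact hv0y
        · intro he
          have := (hlev _ (hPD a h (by omega))).2
          rw [he] at this; omega
      · by_cases h : a = j
        · subst h; simp [hjy]
        · have : ¬ G.Adj (P a) y := fun h' => hmin a (by omega) ⟨by omega, h'⟩
          simp only [this, false_iff]; omega
    · obtain ⟨hsr, hsd⟩ := hqup (b - (j + 1)) (by omega) (by omega)
      rcases Nat.eq_zero_or_pos a with h | h
      · have := hqind (b - (j+1)) r (by omega) le_rfl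
        rw [h, hP0, ← hqR]
        refine ⟨this.1.symm, ?_⟩
        rw [G.adj_comm, this.2]; omega
      · have hl := (hlev _ (hPD a h (by omega))).2
        constructor
        · intro he; rw [he] at hl; omega
        · have : ¬ G.Adj (P a) (q (b - (j+1))) := by
            intro h'
            have := dist_step hsr h'.symm
            omega
          simp only [this, false_iff]; omega
  · rw [if_neg haj]
    have := hqind (a - (j+1)) (b - (j+1)) (by omega) (by omega)
    refine ⟨this.1, this.2.trans ?_⟩
    omega

/-- let `ℓ ≥ 3`, `κ ≥ 1`, and let `G` have no induced cycle of
length more than `ℓ`, with `χ(N(v)) ≤ κ` and `χ(N²(v)) ≤ κ` for every vertex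
`v`. Then `χ(G) ≤ (2ℓ − 2)κ`. -/
theorem stmt_13 {V : Type*} [Fintype V] (G : SimpleGraph V) (ℓ κ : ℕ)
    (hℓ : 3 ≤ ℓ) (hκ : 1 ≤ κ)
    (hnohole : ∀ n : ℕ, ℓ < n → ¬ HasInducedCycle G n)
    (hnbr : ∀ v : V, (G.induce (G.neighborSet v)).chromaticNumber ≤ (κ : ℕ∞))
    (hnbr2 : ∀ v : V,
      (G.induce {u : V | G.dist v u = 2}).chromaticNumber ≤ (κ : ℕ∞)) :
    G.chromaticNumber ≤ ((2 * ℓ - 2) * κ : ℕ∞) := by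
  classical
  obtain ⟨N, rfl⟩ : ∃ N, ℓ = N + 2 := ⟨ℓ - 2, by omega⟩
  have hcast : ((2 * ((N + 2 : ℕ) : ℕ∞) - 2) * κ : ℕ∞)
      = (((N + 1) * κ + (N + 1) * κ : ℕ) : ℕ∞) := by
    have : (2 * ((N + 2 : ℕ) : ℕ∞) - 2 : ℕ∞) = ((2 * (N + 2) - 2 : ℕ) : ℕ∞) := by
      push_cast; rfl
    rw [this, ← Nat.cast_mul, show 2 * (N + 2) - 2 = (N + 1) + (N + 1) by omega, Nat.add_mul]
  rw [hcast, SimpleGraph.chromaticNumber_le_iff_colorable]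
  have h1 := fun v => Col.of_chrom (hnbr v)
  have h2 := fun v => Col.of_chrom (hnbr2 v)
  suffices hC : Col G Set.univ ((N + 1) * κ + (N + 1) * κ) by
    obtain ⟨c, hc⟩ := hC
    refine ⟨SimpleGraph.Coloring.mk (fun v => (⟨c v, (hc v trivial).1⟩ : Fin _)) ?_⟩
    intro v w hvw he
    exact (hc v trivial).2 w trivial hvw (by simpa using he)
  by_contra hC
  obtain ⟨T, -, hTc, hTconn⟩ := exists_conn hC
  have hne : ∃ t, t ∈ T := by
    by_contra hn
    push Not at hn
    exact hTc ⟨fun _ => 0, fun v hv => absurd hv (hn v)⟩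
  obtain ⟨z, hz⟩ := hne
  have hreach : ∀ u ∈ T, G.Reachable z u :=
    hTconn {u | G.Reachable z u} ⟨z, hz, SimpleGraph.Reachable.refl z⟩
      (fun a ha _ b _ hab => SimpleGraph.Reachable.trans ha hab.reachable)
  have hlev : ∃ k, ¬ Col G {u | u ∈ T ∧ G.dist z u = k} ((N + 1) * κ) := by
    by_contra hn
    push Not at hn
    choose c hc using hn
    apply hTc
    refine ⟨fun v => c (G.dist z v) v + (G.dist z v % 2) * ((N + 1) * κ), fun v hv => ?_⟩
    have hv1 := (hc _ v ⟨hv, rfl⟩).1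
    constructor
    · rcases Nat.mod_two_eq_zero_or_one (G.dist z v) with h | h <;> simp only [h] <;> omega
    · intro u hu hvu
      have hu1 := (hc _ u ⟨hu, rfl⟩).1
      have d1 := dist_step (hreach v hv) hvu
      have d2 := dist_step (hreach u hu) hvu.symm
      by_cases he : G.dist z u = G.dist z v
      · have := (hc _ v ⟨hv, rfl⟩).2 u ⟨hu, he⟩ hvu
        simp only [he]; omega
      · rcases Nat.mod_two_eq_zero_or_one (G.dist z v) with h | h <;>
        rcases Nat.mod_two_eq_zero_or_one (G.dist z u) with h' | h' <;>
        simp only [h, h'] <;> omega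
  obtain ⟨k, hk⟩ := hlev
  rcases k with _ | k
  · apply hk
    refine ⟨fun _ => 0, fun v hv => ⟨by positivity, fun u hu hvu => ?_⟩⟩
    have e1 := (hreach v hv.1).dist_eq_zero_iff.1 hv.2
    have e2 := (hreach u hu.1).dist_eq_zero_iff.1 hu.2
    exact absurd (e1.symm.trans e2) hvu.ne
  · obtain ⟨D0, hD0s, hD0c, hD0⟩ := exists_conn hk
    obtain ⟨n, hn, hcyc⟩ := level_hole h1 h2 z k hD0
      (fun u hu => ⟨hreach u (hD0s hu).1, (hD0s hu).2⟩) (by omega) hD0c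
    exact hnohole n (by omega) hcyc
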